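/- arXiv:0704.2903 — 3 statements merged into one kernel-verified Lean document; each statement's English description precedes it below -/
import Mathlib

section
/- Let H be a finite-dimensional complex Hilbert space, let Q be a finite set of questions with an ordering q_1,…,q_n, let A be a finite answer set, and for each q ∈ Q let {W_q^a}_{a∈A} be a projective measurement on H. Let ψ ∈ H ⊗ H be a unit vector invariant under swapping the two tensor factors, and let π be a symmetric probability distribution on Q × Q with marginal π(q), ordered so that π(q_1) ≥ π(q_2) ≥ … ≥ π(q_n). Suppose that (a) Σ_{i,j} π(q_i)π(q_j) Σ_{a,a'} ‖(W_{q_i}^{a} ⊗ W_{q_j}^{a'} − W_{q_j}^{a'} ⊗ W_{q_i}^{a})ψ‖² ≤ 24ε and (b) Σ_i π(q_i) Σ_a ‖(W_{q_i}^{a} ⊗ Id − Id ⊗ W_{q_i}^{a})ψ‖² ≤ 216ε. Define the joint distribution D(a_1,…,a_n) = ‖(W_{q_n}^{a_n}⋯W_{q_1}^{a_1} ⊗ Id)ψ‖², let p_class(a,a'|q_i,q_j) be the marginal of D on coordinates (i,j), and let p_q(a,a'|q_i,q_j) = ‖(W_{q_i}^{a} ⊗ W_{q_j}^{a'})ψ‖².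 Then the weighted statistical distance satisfies Σ_{i,j} π(q_i,q_j) Σ_{a,a'} |p_class(a,a'|q_i,q_j) − p_q(a,a'|q_i,q_j)| ≤ 70·n·ε^{1/4}. -/
open scoped Kronecker

/-- Squared ℓ²-norm of a vector in a finite-dimensional complex Hilbert space. -/
noncomputable def nsq {ι : Type*} [Fintype ι] (v : ι → ℂ) : ℝ := ∑ i, ‖v i‖ ^ 2

/-- A projective measurement with outcome set `A`: a family of orthogonal projections
summing to the identity. -/
def IsProjMeas {n : Type*} [Fintype n] [DecidableEq n] {A : Type*} [Fintype A]
    (W : A → Matrix n n ℂ) : Prop :=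
  (∀ a, (W a).IsHermitian) ∧ (∀ a, W a * W a = W a) ∧ (∑ a, W a) = 1

/-- The ordered product `W_{q_n}^{a_n} ⋯ W_{q_1}^{a_1}` (indices decreasing from left to
right) of the projectors chosen by the answer tuple `f`. -/
noncomputable def descProd {d n : ℕ} {A : Type*}
    (W : Fin n → A → Matrix (Fin d) (Fin d) ℂ) (f : Fin n → A) :
    Matrix (Fin d) (Fin d) ℂ :=
  (((List.finRange n).reverse.map fun l => W l (f l)).prod)

open Matrix Finset

section SquaredNorm

variable {ι : Type*} [Fintype ι]

lemma nsq_nonneg (v : ι → ℂ) : 0 ≤ nsq v := by unfold nsq; positivity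

lemma nsq_eq_norm_sq (v : ι → ℂ) : nsq v = ‖WithLp.toLp 2 v‖ ^ 2 := by
  rw [EuclideanSpace.norm_sq_eq]; rfl

lemma ofReal_nsq (v : ι → ℂ) : (nsq v : ℂ) = star v ⬝ᵥ v := by
  simp [nsq, dotProduct, Complex.conj_mul']

lemma abs_nsq_sub_nsq_le (u v : ι → ℂ) :
    |nsq u - nsq v| ≤ √(nsq (u - v)) * (√(nsq u) + √(nsq v)) := by
  simp only [nsq_eq_norm_sq, WithLp.toLp_sub, Real.sqrt_sq (norm_nonneg _)]
  rw [sq_sub_sq, abs_mul, abs_of_nonneg (by positivity), mul_comm]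
  gcongr
  exact abs_norm_sub_norm_le _ _

lemma sum_abs_nsq_sub_nsq_le {X : Type*} [Fintype X] (u v : X → ι → ℂ)
    (hu : ∑ x, nsq (u x) = 1) (hv : ∑ x, nsq (v x) = 1) :
    ∑ x, |nsq (u x) - nsq (v x)| ≤ 2 * √(∑ x, nsq (u x - v x)) := by
  have h4 : ∑ x, (√(nsq (u x)) + √(nsq (v x))) ^ 2 ≤ 2 ^ 2 := by
    calc _ ≤ ∑ x, (2 * nsq (u x) + 2 * nsq (v x)) := by
          refine sum_le_sum fun x _ => ?_
          nlinarith [sq_nonneg (√(nsq (u x)) - √(nsq (v x))),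
            Real.sq_sqrt (nsq_nonneg (u x)), Real.sq_sqrt (nsq_nonneg (v x))]
      _ = 2 ^ 2 := by rw [sum_add_distrib, ← mul_sum, ← mul_sum, hu, hv]; norm_num
  calc _ ≤ ∑ x, √(nsq (u x - v x)) * (√(nsq (u x)) + √(nsq (v x))) :=
        sum_le_sum fun x _ => abs_nsq_sub_nsq_le _ _
    _ ≤ √(∑ x, √(nsq (u x - v x)) ^ 2) * √(∑ x, (√(nsq (u x)) + √(nsq (v x))) ^ 2) :=
        Real.sum_mul_le_sqrt_mul_sqrt _ _ _
    _ ≤ √(∑ x, nsq (u x - v x)) * 2 := by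
        simp only [Real.sq_sqrt (nsq_nonneg _)]
        gcongr
        exact (Real.sqrt_le_sqrt h4).trans_eq (Real.sqrt_sq (by norm_num))
    _ = _ := mul_comm _ _

/-- A family of Kraus operators: `∑ K_y† K_y = 1`. -/
def IsKraus [DecidableEq ι] {Y : Type*} [Fintype Y] (K : Y → Matrix ι ι ℂ) : Prop :=
  ∑ y, (K y)ᴴ * K y = 1

variable [DecidableEq ι] {Y X : Type*} [Fintype Y] [Fintype X]

lemma IsKraus.sum_nsq {K : Y → Matrix ι ι ℂ} (hK : IsKraus K) (v : ι → ℂ) :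
    ∑ y, nsq (K y *ᵥ v) = nsq v := by
  have : ∑ y, (nsq (K y *ᵥ v) : ℂ) = nsq v := by
    simp only [ofReal_nsq, star_mulVec, ← dotProduct_mulVec, mulVec_mulVec]
    rw [← dotProduct_sum, ← sum_mulVec, hK, one_mulVec]
  exact_mod_cast this

lemma IsProjMeas.isKraus {A : Type*} [Fintype A] {W : A → Matrix ι ι ℂ} (hW : IsProjMeas W) :
    IsKraus W := by
  unfold IsKraus
  simp only [(hW.1 _).eq, hW.2.1, hW.2.2]

lemma IsKraus.kronecker {K : Y → Matrix ι ι ℂ} {L : X → Matrix ι ι ℂ}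
    (hK : IsKraus K) (hL : IsKraus L) :
    IsKraus fun p : Y × X => K p.1 ⊗ₖ L p.2 := by
  unfold IsKraus at *
  simp only [conjTranspose_kronecker, ← mul_kronecker_mul]
  rw [Fintype.sum_prod_type]
  trans (∑ y, (K y)ᴴ * K y) ⊗ₖ (∑ x, (L x)ᴴ * L x)
  swap
  · rw [hK, hL, one_kronecker_one]
  ext ⟨i, i'⟩ ⟨j, j'⟩
  simp [Matrix.sum_apply, Finset.sum_mul_sum]

lemma IsKraus.comp_equiv {K : Y → Matrix ι ι ℂ} (hK : IsKraus K) (e : X ≃ Y) :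
    IsKraus fun x => K (e x) :=
  (e.sum_comp fun y => (K y)ᴴ * K y).trans hK

lemma isKraus_one : IsKraus fun _ : Unit => (1 : Matrix ι ι ℂ) := by
  simp [IsKraus]

lemma IsKraus.kronecker_one {K : Y → Matrix ι ι ℂ} (hK : IsKraus K) :
    IsKraus fun y => K y ⊗ₖ (1 : Matrix ι ι ℂ) := by
  have := hK.kronecker (isKraus_one (ι := ι))
  unfold IsKraus at *
  simpa [Fintype.sum_prod_type] using this

lemma IsKraus.one_kronecker {K : Y → Matrix ι ι ℂ} (hK : IsKraus K) :
    IsKraus fun y => (1 : Matrix ι ι ℂ) ⊗ₖ K y := by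
  have := (isKraus_one (ι := ι)).kronecker hK
  unfold IsKraus at *
  simpa [Fintype.sum_prod_type] using this

lemma IsKraus.mul {K : Y → Matrix ι ι ℂ} {L : X → Matrix ι ι ℂ}
    (hK : IsKraus K) (hL : IsKraus L) :
    IsKraus fun p : X × Y => K p.2 * L p.1 := by
  unfold IsKraus at *
  rw [Fintype.sum_prod_type, ← hL]
  refine sum_congr rfl fun x _ => ?_
  calc _ = (L x)ᴴ * (∑ y, (K y)ᴴ * K y) * L x := by
        simp [mul_sum, sum_mul, Matrix.mul_assoc]
    _ = _ := by rw [hK, Matrix.mul_one]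

/-- Post-processing by a Kraus family does not increase the statistical distance between
the outcome distributions of two measurements. -/
lemma IsKraus.sum_abs_sub_le {K : Y → Matrix ι ι ℂ} (hK : IsKraus K)
    {U V : X → Matrix ι ι ℂ} (hU : IsKraus U) (hV : IsKraus V) {ψ : ι → ℂ} (hψ : nsq ψ = 1) :
    ∑ x, ∑ y, |nsq ((K y * U x) *ᵥ ψ) - nsq ((K y * V x) *ᵥ ψ)|
      ≤ 2 * √(∑ x, nsq ((U x - V x) *ᵥ ψ)) := by
  rw [← Fintype.sum_prod_type']
  refine (sum_abs_nsq_sub_nsq_le (fun p : X × Y => (K p.2 * U p.1) *ᵥ ψ)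
    (fun p : X × Y => (K p.2 * V p.1) *ᵥ ψ) ?_ ?_).trans_eq ?_
  · rw [(hK.mul hU).sum_nsq, hψ]
  · rw [(hK.mul hV).sum_nsq, hψ]
  · simp only [← sub_mulVec, ← mul_sub]
    rw [Fintype.sum_prod_type]
    simp only [← mulVec_mulVec, hK.sum_nsq]

omit [DecidableEq ι] in
lemma nsq_kronecker_swap (M N : Matrix ι ι ℂ) {ψ : ι × ι → ℂ}
    (hsym : ∀ i j, ψ (i, j) = ψ (j, i)) :
    nsq ((M ⊗ₖ N) *ᵥ ψ) = nsq ((N ⊗ₖ M) *ᵥ ψ) := by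
  unfold nsq
  refine Fintype.sum_equiv (Equiv.prodComm ι ι) _ _ fun p => ?_
  congr 2
  simp only [mulVec, dotProduct]
  refine Fintype.sum_equiv (Equiv.prodComm ι ι) _ _ fun q => ?_
  simp only [kroneckerMap_apply, Equiv.prodComm_apply, Prod.fst_swap, Prod.snd_swap]
  rw [hsym q.1 q.2, mul_comm (M _ _)]
  rfl

end SquaredNorm

lemma sum_abs_label_sub_le {F B : Type*} [Fintype F] [Fintype B] [DecidableEq B] (l : F → B)
    (g h : F → ℝ) :
    ∑ b, |(∑ f, if l f = b then g f else 0) - ∑ f, if l f = b then h f else 0|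
      ≤ ∑ f, |g f - h f| := by
  calc _ ≤ ∑ b, ∑ f, if l f = b then |g f - h f| else 0 := by
        refine sum_le_sum fun b _ => ?_
        rw [← sum_sub_distrib]
        refine (abs_sum_le_sum_abs _ _).trans (sum_le_sum fun f _ => ?_)
        split_ifs <;> simp
    _ = _ := by rw [sum_comm]; simp

section Sequential

variable {d : ℕ} {A : Type*} [Fintype A]

omit [Fintype A] in
lemma descProd_cons {n : ℕ} (W : Fin (n + 1) → A → Matrix (Fin d) (Fin d) ℂ) (a : A)
    (f : Fin n → A) :
    descProd W (Fin.cons a f : Fin (n + 1) → A) = descProd (fun k => W k.succ) f * W 0 a := by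
  simp [descProd, List.finRange_succ, List.map_reverse, Function.comp_def]

lemma sum_fin_cons {n : ℕ} (g : (Fin (n + 1) → A) → ℝ) :
    ∑ f, g f = ∑ a, ∑ f : Fin n → A, g (Fin.cons a f : Fin (n + 1) → A) := by
  rw [← Fintype.sum_prod_type']
  exact (Fintype.sum_equiv (Fin.consEquiv fun _ => A) _ _ fun _ => rfl).symm

lemma isKraus_descProd {n : ℕ} (W : Fin n → A → Matrix (Fin d) (Fin d) ℂ)
    (hW : ∀ i, IsProjMeas (W i)) : IsKraus (descProd W) := by
  induction n with
  | zero => simp [IsKraus, descProd]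
  | succ n ih =>
    have h := (ih (fun k => W k.succ) fun k => hW _).mul (hW 0).isKraus
    unfold IsKraus at *
    rw [← h]
    refine (Fintype.sum_equiv (Fin.consEquiv fun _ => A) _ _ fun p => ?_).symm
    simp only [← descProd_cons]
    rfl

/-- Failure of a measurement to be consistent between the two tensor factors. -/
noncomputable def inconsistency (ψ : Fin d × Fin d → ℂ) (V : A → Matrix (Fin d) (Fin d) ℂ) : ℝ :=
  ∑ a, nsq ((V a ⊗ₖ (1 : Matrix (Fin d) (Fin d) ℂ)
    - (1 : Matrix (Fin d) (Fin d) ℂ) ⊗ₖ V a).mulVec ψ)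

/-- Failure of two measurements to be exchangeable between the two tensor factors. -/
noncomputable def exchangeDefect (ψ : Fin d × Fin d → ℂ)
    (V W : A → Matrix (Fin d) (Fin d) ℂ) : ℝ :=
  ∑ a, ∑ a', nsq ((V a ⊗ₖ W a' - W a' ⊗ₖ V a).mulVec ψ)

lemma inconsistency_nonneg (ψ : Fin d × Fin d → ℂ) (V : A → Matrix (Fin d) (Fin d) ℂ) :
    0 ≤ inconsistency ψ V := sum_nonneg fun _ _ => nsq_nonneg _

lemma exchangeDefect_nonneg (ψ : Fin d × Fin d → ℂ) (V W : A → Matrix (Fin d) (Fin d) ℂ) :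
    0 ≤ exchangeDefect ψ V W := sum_nonneg fun _ _ => sum_nonneg fun _ _ => nsq_nonneg _

variable {ψ : Fin d × Fin d → ℂ}

/-- A measurement applied first may be moved to the second tensor factor. -/
lemma sum_abs_move_le (hψ : nsq ψ = 1) {Y : Type*} [Fintype Y]
    {K : Y → Matrix (Fin d) (Fin d) ℂ} (hK : IsKraus K)
    {V : A → Matrix (Fin d) (Fin d) ℂ} (hV : IsProjMeas V) :
    ∑ a, ∑ y, |nsq (((K y * V a) ⊗ₖ (1 : Matrix (Fin d) (Fin d) ℂ)) *ᵥ ψ)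
        - nsq ((K y ⊗ₖ V a) *ᵥ ψ)| ≤ 2 * √(inconsistency ψ V) := by
  have h := hK.kronecker_one.sum_abs_sub_le hV.isKraus.kronecker_one hV.isKraus.one_kronecker hψ
  simp only [← mul_kronecker_mul, Matrix.one_mul, Matrix.mul_one] at h
  exact h

/-- A measurement applied first may be dropped. -/
lemma sum_abs_drop_le (hψ : nsq ψ = 1) {Y : Type*} [Fintype Y]
    {K : Y → Matrix (Fin d) (Fin d) ℂ} (hK : IsKraus K)
    {V : A → Matrix (Fin d) (Fin d) ℂ} (hV : IsProjMeas V) :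
    ∑ y, |∑ a, nsq (((K y * V a) ⊗ₖ (1 : Matrix (Fin d) (Fin d) ℂ)) *ᵥ ψ)
        - nsq ((K y ⊗ₖ (1 : Matrix (Fin d) (Fin d) ℂ)) *ᵥ ψ)| ≤ 2 * √(inconsistency ψ V) := by
  refine le_trans ?_ (sum_abs_move_le hψ hK hV)
  rw [sum_comm]
  refine sum_le_sum fun y _ => ?_
  refine le_trans (le_of_eq ?_) (abs_sum_le_sum_abs _ _)
  rw [sum_sub_distrib]
  congr 2
  rw [← hV.isKraus.one_kronecker.sum_nsq]
  simp only [mulVec_mulVec, ← mul_kronecker_mul, Matrix.one_mul, Matrix.mul_one]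

lemma sum_nsq_kronecker_left (Z : Matrix (Fin d) (Fin d) ℂ) {Y : Type*} [Fintype Y]
    {K : Y → Matrix (Fin d) (Fin d) ℂ} (hK : IsKraus K) (M : Matrix (Fin d) (Fin d) ℂ) :
    ∑ y, nsq (((K y * M) ⊗ₖ Z) *ᵥ ψ) = nsq ((M ⊗ₖ Z) *ᵥ ψ) := by
  rw [← hK.kronecker_one.sum_nsq]
  simp only [mulVec_mulVec, ← mul_kronecker_mul, Matrix.one_mul]

lemma sum_nsq_kronecker_right (Z : Matrix (Fin d) (Fin d) ℂ) {Y : Type*} [Fintype Y]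
    {K : Y → Matrix (Fin d) (Fin d) ℂ} (hK : IsKraus K) :
    ∑ y, nsq ((Z ⊗ₖ K y) *ᵥ ψ) = nsq ((Z ⊗ₖ (1 : Matrix (Fin d) (Fin d) ℂ)) *ᵥ ψ) := by
  rw [← hK.one_kronecker.sum_nsq]
  simp only [mulVec_mulVec, ← mul_kronecker_mul, Matrix.one_mul, Matrix.mul_one]

lemma IsProjMeas.nsq_mul_eq_zero [DecidableEq A] {W : A → Matrix (Fin d) (Fin d) ℂ}
    (hW : IsProjMeas W) (ψ : Fin d × Fin d → ℂ) {a b : A} (hab : a ≠ b) :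
    nsq (((W b * W a) ⊗ₖ (1 : Matrix (Fin d) (Fin d) ℂ)) *ᵥ ψ) = 0 := by
  have h := sum_nsq_kronecker_left (ψ := ψ) 1 hW.isKraus (W a)
  rw [← add_sum_erase _ _ (mem_univ a), hW.2.1, add_eq_left,
    sum_eq_zero_iff_of_nonneg fun _ _ => nsq_nonneg _] at h
  exact h b (by simp [hab.symm])

/-- A measurement applied after `V` may be dropped if it is exchangeable with `V`. -/
lemma sum_abs_drop_second_le (hψ : nsq ψ = 1) {Y : Type*} [Fintype Y]
    {K : Y → Matrix (Fin d) (Fin d) ℂ} (hK : IsKraus K)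
    {V W : A → Matrix (Fin d) (Fin d) ℂ} (hV : IsProjMeas V) (hW : IsProjMeas W) :
    ∑ a, ∑ y, |∑ b, nsq (((K y * W b * V a) ⊗ₖ (1 : Matrix (Fin d) (Fin d) ℂ)) *ᵥ ψ)
        - nsq (((K y * V a) ⊗ₖ (1 : Matrix (Fin d) (Fin d) ℂ)) *ᵥ ψ)|
      ≤ 2 * √(inconsistency ψ V) + 2 * √(exchangeDefect ψ V W) := by
  have h1 := sum_abs_move_le hψ (hK.mul hW.isKraus) hV
  have h2 := hK.kronecker_one.sum_abs_sub_le (hV.isKraus.kronecker hW.isKraus)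
    ((hW.isKraus.kronecker hV.isKraus).comp_equiv (Equiv.prodComm A A)) hψ
  simp only [← mul_kronecker_mul, Matrix.one_mul, Equiv.prodComm_apply, Prod.fst_swap,
    Prod.snd_swap, Fintype.sum_prod_type] at h1 h2
  refine le_trans ?_ (add_le_add h1 h2)
  rw [← sum_add_distrib]
  refine sum_le_sum fun a _ => ?_
  simp only [← sum_add_distrib]
  rw [sum_comm]
  refine sum_le_sum fun y _ => ?_
  rw [← sum_nsq_kronecker_right (K y * V a) hW.isKraus, ← sum_sub_distrib]
  refine (abs_sum_le_sum_abs _ _).trans (sum_le_sum fun b _ => ?_)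
  rw [abs_sub_comm (nsq ((K y * V a) ⊗ₖ W b *ᵥ ψ))]
  exact abs_sub_le _ _ _

variable [DecidableEq A]

lemma sum_ite_cons_zero {n : ℕ} (g : (Fin (n + 1) → A) → ℝ) (b : A) :
    (∑ f, if f 0 = b then g f else 0)
      = ∑ f : Fin n → A, g (Fin.cons b f : Fin (n + 1) → A) := by
  rw [sum_fin_cons, sum_comm]
  simp

omit [DecidableEq A] in
lemma sum_ite_cons_succ {n : ℕ} (g : (Fin (n + 1) → A) → ℝ) (p : (Fin n → A) → Prop)
    [DecidablePred p] :
    (∑ f, if p (fun k => f k.succ) then g f else 0)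
      = ∑ f : Fin n → A, if p f then ∑ a, g (Fin.cons a f : Fin (n + 1) → A) else 0 := by
  rw [sum_fin_cons, sum_comm]
  refine sum_congr rfl fun f _ => ?_
  simp only [Fin.cons_succ]
  split_ifs <;> simp

/-- Measuring `V` and then the sequence `W` up to `j` yields almost the same joint distribution
of outcomes of `V` and `W j` as measuring `V ⊗ W j`. -/
lemma sum_abs_sequential_after_le (hψ : nsq ψ = 1) (hsym : ∀ i j, ψ (i, j) = ψ (j, i))
    {V : A → Matrix (Fin d) (Fin d) ℂ} (hV : IsProjMeas V) {n : ℕ}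
    (W : Fin n → A → Matrix (Fin d) (Fin d) ℂ) (hW : ∀ i, IsProjMeas (W i)) (j : Fin n) :
    ∑ a, ∑ a', |(∑ f : Fin n → A, if f j = a' then
          nsq (((descProd W f * V a) ⊗ₖ (1 : Matrix (Fin d) (Fin d) ℂ)) *ᵥ ψ) else 0)
        - nsq ((V a ⊗ₖ W j a') *ᵥ ψ)|
      ≤ ∑ k, if k ≤ j then 2 * √(inconsistency ψ V) + 2 * √(exchangeDefect ψ V (W k)) else 0 := by
  induction n with
  | zero => exact j.elim0
  | succ n ih =>
    have hK := isKraus_descProd (fun k => W k.succ) fun k => hW _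
    induction j using Fin.cases with
    | zero =>
      simp only [sum_ite_cons_zero, descProd_cons, Matrix.mul_assoc,
        sum_nsq_kronecker_left 1 hK]
      have h := sum_abs_move_le hψ (hW 0).isKraus hV
      rw [Fin.sum_univ_succ]
      simp only [nsq_kronecker_swap (V _) _ hsym]
      simp
      linarith [Real.sqrt_nonneg (exchangeDefect ψ V (W 0))]
    | succ j =>
      have h1 := sum_abs_drop_second_le hψ hK hV (hW 0)
      have h2 := ih (fun k => W k.succ) (fun k => hW _) j
      rw [Fin.sum_univ_succ]
      simp only [Fin.zero_le, if_true, Fin.succ_le_succ_iff]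
      refine le_trans ?_ (add_le_add h1 h2)
      rw [← sum_add_distrib]
      refine sum_le_sum fun a _ => ?_
      refine le_trans ?_ (add_le_add_left (sum_abs_label_sub_le (fun f => f j) _ _) _)
      rw [← sum_add_distrib]
      refine sum_le_sum fun a' _ => ?_
      rw [sum_ite_cons_succ _ fun f => f j = a']
      simp only [descProd_cons]
      exact abs_sub_le _ _ _

/-- The classical and quantum statistics of a pair `i ≤ j` of questions are close. -/
lemma sum_abs_sequential_le (hψ : nsq ψ = 1) (hsym : ∀ i j, ψ (i, j) = ψ (j, i)) {n : ℕ}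
    (W : Fin n → A → Matrix (Fin d) (Fin d) ℂ) (hW : ∀ i, IsProjMeas (W i)) (i j : Fin n)
    (hij : i ≤ j) :
    ∑ a, ∑ a', |(∑ f : Fin n → A, if f i = a ∧ f j = a' then
          nsq ((descProd W f ⊗ₖ (1 : Matrix (Fin d) (Fin d) ℂ)) *ᵥ ψ) else 0)
        - nsq ((W i a ⊗ₖ W j a') *ᵥ ψ)|
      ≤ ∑ k, if k ≤ j then 2 * √(inconsistency ψ (W k)) + (2 * √(inconsistency ψ (W i))
          + 2 * √(exchangeDefect ψ (W i) (W k))) else 0 := by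
  induction n with
  | zero => exact j.elim0
  | succ n ih =>
    have hK := isKraus_descProd (fun k => W k.succ) fun k => hW _
    induction j using Fin.cases with
    | zero =>
      obtain rfl : i = 0 := Fin.le_zero_iff.mp hij
      have h := sum_abs_move_le hψ (hW 0).isKraus (hW 0)
      rw [Fin.sum_univ_succ]
      have key : ∀ a a', (∑ f : Fin (n + 1) → A, if f 0 = a ∧ f 0 = a' then
          nsq ((descProd W f ⊗ₖ (1 : Matrix (Fin d) (Fin d) ℂ)) *ᵥ ψ) else 0)
          = nsq (((W 0 a' * W 0 a) ⊗ₖ (1 : Matrix (Fin d) (Fin d) ℂ)) *ᵥ ψ) := by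
        intro a a'
        simp only [ite_and, sum_ite_cons_zero, Fin.cons_zero]
        by_cases haa : a = a'
        · subst haa
          simp only [if_true, descProd_cons, sum_nsq_kronecker_left 1 hK, (hW 0).2.1]
        · simp [haa, (hW 0).nsq_mul_eq_zero ψ haa]
      simp only [key]
      have swap : ∀ a a', nsq ((W 0 a ⊗ₖ W 0 a') *ᵥ ψ) = nsq ((W 0 a' ⊗ₖ W 0 a) *ᵥ ψ) :=
        fun a a' => nsq_kronecker_swap _ _ hsym
      refine (h.trans' (le_of_eq ?_)).trans (le_add_of_le_of_nonneg ?_ ?_)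
      · exact sum_congr rfl fun a _ => sum_congr rfl fun a' _ => by rw [swap a a']
      · rw [if_pos le_rfl]
        exact le_add_of_nonneg_right (by positivity)
      · exact sum_nonneg fun k _ => by split_ifs <;> positivity
    | succ j =>
      induction i using Fin.cases with
      | zero =>
        refine le_trans (le_of_eq ?_) ((sum_abs_sequential_after_le hψ hsym (hW 0)
          (fun k => W k.succ) (fun k => hW _) j).trans ?_)
        · simp only [ite_and, sum_ite_cons_zero, Fin.cons_succ, descProd_cons]
        · rw [Fin.sum_univ_succ]
          simp only [Fin.succ_le_succ_iff]
          refine le_add_of_nonneg_of_le (by simp; positivity) (sum_le_sum fun k _ => ?_)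
          split_ifs
          · linarith [Real.sqrt_nonneg (inconsistency ψ (W k.succ))]
          · rfl
      | succ i =>
        have h1 := sum_abs_drop_le hψ hK (hW 0)
        have h2 := ih (fun k => W k.succ) (fun k => hW _) i j (Fin.succ_le_succ_iff.mp hij)
        rw [Fin.sum_univ_succ]
        simp only [Fin.zero_le, if_true, Fin.succ_le_succ_iff]
        refine le_trans ?_ (add_le_add (h1.trans (le_add_of_nonneg_right (by positivity))) h2)
        refine le_trans ?_ (add_le_add_left
          (sum_abs_label_sub_le (fun f : Fin n → A => (f i, f j)) _ _) _)
        rw [Fintype.sum_prod_type, ← sum_add_distrib]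
        refine sum_le_sum fun a _ => ?_
        rw [← sum_add_distrib]
        refine sum_le_sum fun a' _ => ?_
        rw [sum_ite_cons_succ _ fun f => f i = a ∧ f j = a']
        simp only [descProd_cons, Prod.mk.injEq]
        exact abs_sub_le _ _ _

/-- The total variation between classical and quantum statistics is at most two. -/
lemma sum_abs_sequential_le_two (hψ : nsq ψ = 1) {n : ℕ}
    (W : Fin n → A → Matrix (Fin d) (Fin d) ℂ) (hW : ∀ i, IsProjMeas (W i)) (i j : Fin n) :
    ∑ a, ∑ a', |(∑ f : Fin n → A, if f i = a ∧ f j = a' then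
          nsq ((descProd W f ⊗ₖ (1 : Matrix (Fin d) (Fin d) ℂ)) *ᵥ ψ) else 0)
        - nsq ((W i a ⊗ₖ W j a') *ᵥ ψ)| ≤ 2 := by
  have h1 : ∑ a, ∑ a', (∑ f : Fin n → A, if f i = a ∧ f j = a' then
      nsq ((descProd W f ⊗ₖ (1 : Matrix (Fin d) (Fin d) ℂ)) *ᵥ ψ) else 0) = 1 := by
    rw [← hψ, ← (isKraus_descProd W hW).kronecker_one.sum_nsq ψ, ← Fintype.sum_prod_type',
      sum_comm]
    refine sum_congr rfl fun f _ => ?_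
    rw [Fintype.sum_prod_type]
    rw [sum_eq_single (f i) (fun a _ h => by simp [Ne.symm h]) (by simp)]
    simp
  have h2 : ∑ a, ∑ a', nsq ((W i a ⊗ₖ W j a') *ᵥ ψ) = 1 := by
    rw [← hψ, ← ((hW i).isKraus.kronecker (hW j).isKraus).sum_nsq ψ, Fintype.sum_prod_type]
  refine le_trans (sum_le_sum fun a _ => sum_le_sum fun a' _ => abs_sub _ _) ?_
  simp only [sum_add_distrib, abs_of_nonneg (nsq_nonneg _)]
  rw [h2]
  have h3 : ∀ a a', |∑ f : Fin n → A, if f i = a ∧ f j = a' then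
      nsq ((descProd W f ⊗ₖ (1 : Matrix (Fin d) (Fin d) ℂ)) *ᵥ ψ) else 0|
      = ∑ f : Fin n → A, if f i = a ∧ f j = a' then
      nsq ((descProd W f ⊗ₖ (1 : Matrix (Fin d) (Fin d) ℂ)) *ᵥ ψ) else 0 := fun a a' =>
    abs_of_nonneg (sum_nonneg fun f _ => by split_ifs <;> simp [nsq_nonneg])
  simp only [h3, h1]
  norm_num

end Sequential

lemma sum_sqrt_mul_sqrt_le {n : ℕ} (w E : Fin n → Fin n → ℝ) (hw : ∀ j k, 0 ≤ w j k)
    (hE : ∀ j k, 0 ≤ E j k) {t : ℝ} (h : ∑ j, ∑ k, w j k * E j k ≤ 225 * t ^ 4) :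
    ∑ j, ∑ k, √(w j k) * √(E j k) ≤ 15 * n * t ^ 2 := by
  refine abs_le_of_sq_le_sq' ?_ (by positivity) |>.2
  rw [← Fintype.sum_prod_type']
  refine sq_sum_le_card_mul_sum_sq.trans ?_
  simp only [mul_pow, Real.sq_sqrt (hw _ _), Real.sq_sqrt (hE _ _), Fintype.sum_prod_type]
  simp only [card_univ, Fintype.card_prod, Fintype.card_fin]
  push_cast
  calc _ ≤ (n * n : ℝ) * (225 * t ^ 4) := by gcongr
    _ = _ := by ring

/-- Averaging the pairwise bounds over the questions: if the cost of a pair `i ≤ j` is a sum of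
square-root defects over the questions up to `j`, the mean cost is quadratic in their number. -/
lemma sum_mul_le_of_le_sum_sqrt {n : ℕ} (π T : Fin n → Fin n → ℝ) (p B : Fin n → ℝ)
    (C : Fin n → Fin n → ℝ) (hπ0 : ∀ i j, 0 ≤ π i j) (hπsym : ∀ i j, π i j = π j i)
    (hp : ∀ i, p i = ∑ l, π i l) (hp1 : ∑ i, p i = 1)
    (hord : ∀ i j, i ≤ j → p j ≤ p i)
    (hB : ∀ i, 0 ≤ B i) (hC : ∀ i j, 0 ≤ C i j)
    (hTsym : ∀ i j, T i j = T j i)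
    (hT : ∀ i j, i ≤ j →
      T i j ≤ ∑ k, if k ≤ j then 2 * √(B k) + (2 * √(B i) + 2 * √(C i k)) else 0)
    {t : ℝ} (hBt : ∑ i, p i * B i ≤ 225 * t ^ 4)
    (hCt : ∑ i, ∑ j, p i * p j * C i j ≤ 225 * t ^ 4) :
    ∑ i, ∑ j, π i j * T i j ≤ 180 * n ^ 2 * t ^ 2 := by
  have hp0 : ∀ i, 0 ≤ p i := fun i => hp i ▸ sum_nonneg fun j _ => hπ0 i j
  have hle : ∀ i j, π i j ≤ p i := fun i j =>
    hp i ▸ single_le_sum (f := fun l => π i l) (fun l _ => hπ0 i l) (mem_univ j)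
  have hle' : ∀ i j, π i j ≤ p j := fun i j => hπsym i j ▸ hle j i
  set r : Fin n → Fin n → ℝ := fun i j => √(p i * p j)
  set R : Fin n → Fin n → ℝ := fun i j =>
    ∑ k, (2 * (r j k * √(B k)) + (2 * (r j i * √(B i)) + 2 * (r i k * √(C i k)))) with hR
  have hR0 : ∀ i j, 0 ≤ R i j := fun i j => sum_nonneg fun k _ => by positivity
  have hbound : ∀ i j, i ≤ j → π i j * T i j ≤ R i j := by
    intro i j hij
    refine (mul_le_mul_of_nonneg_left (hT i j hij) (hπ0 i j)).trans ?_
    rw [mul_sum]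
    refine sum_le_sum fun k _ => ?_
    split_ifs with hk
    · have e1 : π i j ≤ r j k := Real.le_sqrt_of_sq_le <| by
        nlinarith [hπ0 i j, hle' i j, hord k j hk, hp0 j]
      have e2 : π i j ≤ r j i := Real.le_sqrt_of_sq_le <| by
        nlinarith [hπ0 i j, hle' i j, hle i j, hp0 j]
      have e3 : π i j ≤ r i k := Real.le_sqrt_of_sq_le <| by
        nlinarith [hπ0 i j, hle' i j, hle i j, hord k j hk, hp0 i]
      have f1 := mul_le_mul_of_nonneg_right e1 (Real.sqrt_nonneg (B k))
      have f2 := mul_le_mul_of_nonneg_right e2 (Real.sqrt_nonneg (B i))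
      have f3 := mul_le_mul_of_nonneg_right e3 (Real.sqrt_nonneg (C i k))
      linarith
    · rw [mul_zero]; positivity
  have hall : ∀ i j, π i j * T i j ≤ R i j + R j i := by
    intro i j
    rcases le_total i j with h | h
    · linarith [hbound i j h, hR0 j i]
    · rw [hπsym, hTsym]; linarith [hbound j i h, hR0 i j]
  have hBsum : ∑ j, ∑ k, r j k * √(B k) ≤ 15 * n * t ^ 2 := by
    refine sum_sqrt_mul_sqrt_le _ (fun _ k => B k) (fun j k => mul_nonneg (hp0 j) (hp0 k))
      (fun _ k => hB k) ?_
    simp only [mul_assoc, ← mul_sum]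
    rwa [← sum_mul, hp1, one_mul]
  have hCsum : ∑ i, ∑ k, r i k * √(C i k) ≤ 15 * n * t ^ 2 :=
    sum_sqrt_mul_sqrt_le _ C (fun j k => mul_nonneg (hp0 j) (hp0 k)) hC hCt
  have hRsum : ∑ i, ∑ j, R i j ≤ 90 * n ^ 2 * t ^ 2 := by
    have : ∑ i, ∑ j, R i j = 2 * n * (∑ j, ∑ k, r j k * √(B k))
        + (2 * n * (∑ j, ∑ k, r j k * √(B k)) + 2 * n * ∑ i, ∑ k, r i k * √(C i k)) := by
      simp only [hR, sum_add_distrib, sum_const, card_univ, Fintype.card_fin, nsmul_eq_mul,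
        ← mul_sum]
      rw [sum_comm (f := fun i j => r j i * √(B i))]
      ring
    rw [this]
    nlinarith [mul_le_mul_of_nonneg_left hBsum (Nat.cast_nonneg (α := ℝ) n),
      mul_le_mul_of_nonneg_left hCsum (Nat.cast_nonneg (α := ℝ) n)]
  calc _ ≤ ∑ i, ∑ j, (R i j + R j i) := sum_le_sum fun i _ => sum_le_sum fun j _ => hall i j
    _ = 2 * ∑ i, ∑ j, R i j := by
        simp only [sum_add_distrib]
        rw [sum_comm (f := fun i j => R j i)]
        ring
    _ ≤ _ := by linarith

theorem stmt0 {d n : ℕ} {A : Type*} [Fintype A] [DecidableEq A]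
    (W : Fin n → A → Matrix (Fin d) (Fin d) ℂ)
    (hW : ∀ i, IsProjMeas (W i))
    (ψ : Fin d × Fin d → ℂ)
    (hunit : nsq ψ = 1)
    (hsym : ∀ i j, ψ (i, j) = ψ (j, i))
    (π : Fin n → Fin n → ℝ)
    (hπ0 : ∀ i j, 0 ≤ π i j) (hπ1 : ∑ i, ∑ j, π i j = 1)
    (hπsym : ∀ i j, π i j = π j i)
    -- the questions are ordered so that their marginal probabilities are nonincreasing
    (hord : ∀ i j : Fin n, i ≤ j → (∑ l, π j l) ≤ ∑ l, π i l)
    (ε : ℝ)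
    -- (a) pairwise almost-commutation on the entangled state
    (ha : ∑ i, ∑ j, (∑ l, π i l) * (∑ l, π j l) *
        ∑ a, ∑ a', nsq ((W i a ⊗ₖ W j a' - W j a' ⊗ₖ W i a).mulVec ψ) ≤ 24 * ε)
    -- (b) almost-consistency between the two sides
    (hb : ∑ i, (∑ l, π i l) * ∑ a,
        nsq ((W i a ⊗ₖ (1 : Matrix (Fin d) (Fin d) ℂ)
          - (1 : Matrix (Fin d) (Fin d) ℂ) ⊗ₖ W i a).mulVec ψ) ≤ 216 * ε) :
    -- the weighted statistical distance between the classical (sequential-measurement)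
    -- strategy and the quantum strategy is small
    ∑ i, ∑ j, π i j * ∑ a, ∑ a',
        |(∑ f : Fin n → A, if f i = a ∧ f j = a' then
            nsq ((descProd W f ⊗ₖ (1 : Matrix (Fin d) (Fin d) ℂ)).mulVec ψ) else 0)
          - nsq ((W i a ⊗ₖ W j a').mulVec ψ)|
      ≤ 70 * n * ε ^ ((1 : ℝ) / 4) := by
  have hp1 : ∑ i, (∑ l, π i l) = 1 := hπ1
  have hε : 0 ≤ ε := by
    have : 0 ≤ 216 * ε := hb.trans' <| sum_nonneg fun i _ =>
      mul_nonneg (sum_nonneg fun l _ => hπ0 i l) (inconsistency_nonneg ψ (W i))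
    linarith
  set t := ε ^ ((1 : ℝ) / 4) with ht_def
  have ht : 0 ≤ t := Real.rpow_nonneg hε _
  have ht4 : t ^ 4 = ε := by
    rw [ht_def, ← Real.rpow_natCast, ← Real.rpow_mul hε]; norm_num
  rcases le_or_gt 2 (70 * n * t) with hbig | hsmall
  · refine le_trans ?_ hbig
    calc _ ≤ ∑ i, ∑ j, π i j * 2 := sum_le_sum fun i _ => sum_le_sum fun j _ =>
          mul_le_mul_of_nonneg_left (sum_abs_sequential_le_two hunit W hW i j) (hπ0 i j)
      _ = 2 := by simp only [← sum_mul, hπ1, one_mul]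
  · refine (sum_mul_le_of_le_sum_sqrt π _ (fun i => ∑ l, π i l) (fun i => inconsistency ψ (W i))
      (fun i j => exchangeDefect ψ (W i) (W j)) hπ0 hπsym (fun _ => rfl) hp1 hord
      (fun _ => inconsistency_nonneg _ _) (fun _ _ => exchangeDefect_nonneg _ _ _) ?_
      (sum_abs_sequential_le hunit hsym W hW) (t := t) ?_ ?_).trans ?_
    · intro i j
      rw [sum_comm]
      refine sum_congr rfl fun a _ => sum_congr rfl fun a' _ => ?_
      simp only [and_comm, nsq_kronecker_swap (W i a') (W j a) hsym]
    · refine hb.trans ?_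
      linarith
    · refine ha.trans ?_
      linarith
    · have hnt : 0 ≤ n * t := by positivity
      nlinarith
end

section
/- Let H be a finite-dimensional complex Hilbert space, let Q be a finite set of questions with an ordering q_1,…,q_n, let A be a finite answer set, and for each q ∈ Q let {W_q^a}_{a∈A} be a projective measurement on H. Let ψ ∈ H ⊗ H ⊗ H be a unit vector invariant under all permutations of the three tensor factors, and let π be a symmetric probability distribution on Q × Q with marginal π(q), ordered so that π(q_1) ≥ … ≥ π(q_n). For each q let π₂(q) = Σ_a ⟨ψ| W_q^a ⊗ W_q^a ⊗ Id |ψ⟩, and suppose Σ_q π(q) π₂(q) ≥ 1 − ε. Define D(a_1,…,a_n,a'_1,…,a'_n) = ‖(W_{q_n}^{a_n}⋯W_{q_1}^{a_1} ⊗ W_{q_n}^{a'_n}⋯W_{q_1}^{a'_1} ⊗ Id)ψ‖², let p_class(a,a'|q_i,q_j) be the marginal of D on coordinates (a_i, a'_j), and let p_q(a,a'|q_i,q_j) = ⟨ψ| W_{q_i}^{a} ⊗ W_{q_j}^{a'} ⊗ Id |ψ⟩. Then Σ_{i,j} π(q_i,q_j) Σ_{a,a'} |p_class(a,a'|q_i,q_j)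 − p_q(a,a'|q_i,q_j)| ≤ 12·n·√ε. -/
open scoped Kronecker

/-- The (real) expectation value `⟨ψ| M |ψ⟩`. -/
noncomputable def expval {ι : Type*} [Fintype ι] (M : Matrix ι ι ℂ) (ψ : ι → ℂ) : ℝ :=
  (∑ p, (starRingEnd ℂ) (ψ p) * M.mulVec ψ p).re

section Positivity

open scoped ComplexOrder

/-- `expval` as a real-linear functional of the observable. -/
noncomputable def expvalLin {ι : Type*} [Fintype ι] (ψ : ι → ℂ) : Matrix ι ι ℂ →ₗ[ℝ] ℝ where
  toFun M := expval M ψ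
  map_add' M N := by
    simp [expval, Matrix.add_mulVec, mul_add, Finset.sum_add_distrib]
  map_smul' r M := by
    simp [expval, Matrix.smul_mulVec, Finset.mul_sum, mul_left_comm]

theorem expvalLin_eq_re_dotProduct {ι : Type*} [Fintype ι] (ψ : ι → ℂ) (M : Matrix ι ι ℂ) :
    expvalLin ψ M = (star ψ ⬝ᵥ M.mulVec ψ).re := rfl

theorem expvalLin_nonneg {ι : Type*} [Fintype ι] (ψ : ι → ℂ) {M : Matrix ι ι ℂ}
    (hM : M.PosSemidef) : 0 ≤ expvalLin ψ M :=
  hM.re_dotProduct_nonneg ψ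

theorem nsq_eq_re_dotProduct {ι : Type*} [Fintype ι] (v : ι → ℂ) :
    nsq v = (star v ⬝ᵥ v).re := by
  simp [nsq, dotProduct, Complex.sq_norm, Complex.normSq_apply]

theorem expvalLin_one {ι : Type*} [Fintype ι] [DecidableEq ι] (ψ : ι → ℂ) :
    expvalLin ψ 1 = nsq ψ := by
  rw [expvalLin_eq_re_dotProduct, Matrix.one_mulVec, nsq_eq_re_dotProduct]

theorem nsq_mulVec {ι : Type*} [Fintype ι] (M : Matrix ι ι ℂ) (ψ : ι → ℂ) :
    nsq (M.mulVec ψ) = expvalLin ψ (M.conjTranspose * M) := by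
  rw [nsq_eq_re_dotProduct, expvalLin_eq_re_dotProduct, Matrix.star_mulVec,
    ← Matrix.dotProduct_mulVec, Matrix.mulVec_mulVec]

theorem expvalLin_submatrix {ι : Type*} [Fintype ι] (e : ι ≃ ι) {ψ : ι → ℂ}
    (hψ : ∀ i, ψ (e i) = ψ i) (M : Matrix ι ι ℂ) :
    expvalLin ψ (M.submatrix e e) = expvalLin ψ M := by
  simp only [expvalLin_eq_re_dotProduct, dotProduct, Matrix.mulVec, Matrix.submatrix_apply]
  congr 1
  refine Fintype.sum_equiv e _ _ fun i => ?_
  rw [Pi.star_apply, Pi.star_apply, hψ]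
  congr 1
  exact Fintype.sum_equiv e _ _ fun j => by rw [hψ]

/-- Conjugating a positive observable by two close Hermitian operators gives close
expectation values. -/
theorem abs_expvalLin_conj_sub_conj_le {ι : Type*} [Fintype ι] (ψ : ι → ℂ)
    {U V N : Matrix ι ι ℂ} (hU : U.IsHermitian) (hV : V.IsHermitian) (hN : N.PosSemidef)
    {t : ℝ} (ht : 0 < t) :
    |expvalLin ψ (U * N * U) - expvalLin ψ (V * N * V)| ≤
      t / 2 * expvalLin ψ ((U - V) * N * (U - V)) +
        1 / (2 * t) * expvalLin ψ ((U + V) * N * (U + V)) := by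
  have key : ∀ s : ℝ, 0 ≤ s ^ 2 * expvalLin ψ ((U - V) * N * (U - V)) +
      expvalLin ψ ((U + V) * N * (U + V)) +
      2 * s * (expvalLin ψ (U * N * U) - expvalLin ψ (V * N * V)) := by
    intro s
    have hH : (s • (U - V) + (U + V)).IsHermitian :=
      ((hU.sub hV).smul (IsSelfAdjoint.all s)).add (hU.add hV)
    have hp := hN.mul_mul_conjTranspose_same (s • (U - V) + (U + V))
    rw [hH.eq] at hp
    have h0 := expvalLin_nonneg ψ hp
    have he : (s • (U - V) + (U + V)) * N * (s • (U - V) + (U + V)) =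
        s ^ 2 • ((U - V) * N * (U - V)) + (U + V) * N * (U + V) +
          (2 * s) • (U * N * U - V * N * V) := by
      simp only [add_mul, mul_add, sub_mul, mul_sub, smul_mul_assoc, mul_smul_comm]
      module
    rw [he] at h0
    simpa only [map_add, map_sub, map_smul, smul_eq_mul] using h0
  have h1 := key t
  have h2 := key (-t)
  set a := expvalLin ψ ((U - V) * N * (U - V))
  set b := expvalLin ψ ((U + V) * N * (U + V))
  set c := expvalLin ψ (U * N * U) - expvalLin ψ (V * N * V)
  have he : t / 2 * a + 1 / (2 * t) * b = (t ^ 2 * a + b) / (2 * t) := by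
    field_simp
  rw [he, le_div_iff₀ (by positivity)]
  cases abs_cases c <;> nlinarith

theorem sum_abs_expvalLin_conj_sub_conj_le {ι κ A : Type*} [Fintype ι] [DecidableEq ι]
    [Fintype κ] [Fintype A] (ψ : ι → ℂ) {U V : A → Matrix ι ι ℂ} {N : κ → Matrix ι ι ℂ}
    (hU : ∀ a, (U a).IsHermitian) (hV : ∀ a, (V a).IsHermitian)
    (hN : ∀ k, (N k).PosSemidef) (hN1 : ∑ k, N k = 1) {t : ℝ} (ht : 0 < t) :
    ∑ k, |expvalLin ψ (∑ a, U a * N k * U a) - expvalLin ψ (∑ a, V a * N k * V a)| ≤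
      t / 2 * expvalLin ψ (∑ a, (U a - V a) * (U a - V a)) +
        1 / (2 * t) * expvalLin ψ (∑ a, (U a + V a) * (U a + V a)) := by
  have hsum : ∀ D : Matrix ι ι ℂ, expvalLin ψ (D * D) = ∑ k, expvalLin ψ (D * N k * D) := by
    intro D
    rw [← map_sum, ← Finset.sum_mul, ← Finset.mul_sum, hN1, mul_one]
  calc ∑ k, |expvalLin ψ (∑ a, U a * N k * U a) - expvalLin ψ (∑ a, V a * N k * V a)|
      ≤ ∑ k, ∑ a, (t / 2 * expvalLin ψ ((U a - V a) * N k * (U a - V a)) +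
        1 / (2 * t) * expvalLin ψ ((U a + V a) * N k * (U a + V a))) := by
        refine Finset.sum_le_sum fun k _ => ?_
        rw [map_sum, map_sum, ← Finset.sum_sub_distrib]
        refine (Finset.abs_sum_le_sum_abs _ _).trans (Finset.sum_le_sum fun a _ => ?_)
        exact abs_expvalLin_conj_sub_conj_le ψ (hU a) (hV a) (hN k) ht
    _ = _ := by
        rw [Finset.sum_comm, map_sum, map_sum, Finset.mul_sum, Finset.mul_sum,
          ← Finset.sum_add_distrib]
        refine Finset.sum_congr rfl fun a _ => ?_
        rw [Finset.sum_add_distrib, ← Finset.mul_sum, ← Finset.mul_sum, hsum, hsum]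

/-- A finite family of positive semidefinite matrices summing to the identity. -/
def IsPovm {n : Type*} [Fintype n] [DecidableEq n] {β : Type*} [Fintype β]
    (X : β → Matrix n n ℂ) : Prop :=
  (∀ b, (X b).PosSemidef) ∧ ∑ b, X b = 1

/-- The pinching map `X ↦ ∑ a, V a X V a`. -/
def pinch {n : Type*} [Fintype n] {A : Type*} [Fintype A]
    (V : A → Matrix n n ℂ) (X : Matrix n n ℂ) : Matrix n n ℂ :=
  ∑ a, V a * X * V a

theorem IsProjMeas.isPovm {n : Type*} [Fintype n] [DecidableEq n] {A : Type*} [Fintype A]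
    {V : A → Matrix n n ℂ} (hV : IsProjMeas V) : IsPovm V := by
  refine ⟨fun a => ?_, hV.2.2⟩
  have h := Matrix.posSemidef_self_mul_conjTranspose (V a)
  rwa [(hV.1 a).eq, hV.2.1 a] at h

theorem pinch_one {n : Type*} [Fintype n] [DecidableEq n] {A : Type*} [Fintype A]
    {V : A → Matrix n n ℂ} (hV : IsProjMeas V) : pinch V 1 = 1 := by
  simp [pinch, hV.2.1, hV.2.2]

theorem pinch_sum {n : Type*} [Fintype n] {A β : Type*} [Fintype A]
    (V : A → Matrix n n ℂ) (s : Finset β) (X : β → Matrix n n ℂ) :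
    pinch V (∑ b ∈ s, X b) = ∑ b ∈ s, pinch V (X b) := by
  simp only [pinch, Finset.mul_sum, Finset.sum_mul]
  exact Finset.sum_comm

theorem IsPovm.pinch {n : Type*} [Fintype n] [DecidableEq n] {A β : Type*} [Fintype A]
    [Fintype β] {V : A → Matrix n n ℂ} (hV : IsProjMeas V) {X : β → Matrix n n ℂ}
    (hX : IsPovm X) : IsPovm fun b => pinch V (X b) := by
  refine ⟨fun b => Matrix.posSemidef_sum _ fun a _ => ?_, ?_⟩
  · have h := (hX.1 b).mul_mul_conjTranspose_same (V a)
    rwa [(hV.1 a).eq] at h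
  · rw [← pinch_sum, hX.2, pinch_one hV]

theorem IsPovm.foldr_pinch {n : Type*} [Fintype n] [DecidableEq n] {A β : Type*} [Fintype A]
    [Fintype β] {L : List (A → Matrix n n ℂ)} (hL : ∀ V ∈ L, IsProjMeas V)
    {X : β → Matrix n n ℂ} (hX : IsPovm X) : IsPovm fun b => L.foldr _root_.pinch (X b) := by
  induction L with
  | nil => exact hX
  | cons V L ih =>
    exact (ih fun V' h => hL V' (List.mem_cons_of_mem _ h)).pinch (hL V List.mem_cons_self)

/-- The tensor product of three operators on the same space. -/
abbrev tensor₃ {n : Type*} (X Y Z : Matrix n n ℂ) : Matrix (n × n × n) (n × n × n) ℂ :=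
  X ⊗ₖ (Y ⊗ₖ Z)

theorem sum_kronecker {m n A : Type*} (s : Finset A) (X : A → Matrix m m ℂ)
    (Y : Matrix n n ℂ) : (∑ a ∈ s, X a) ⊗ₖ Y = ∑ a ∈ s, X a ⊗ₖ Y := by
  ext i j
  simp [Matrix.sum_apply, Finset.sum_mul]

theorem kronecker_sum {m n A : Type*} (s : Finset A) (X : Matrix m m ℂ)
    (Y : A → Matrix n n ℂ) : X ⊗ₖ (∑ a ∈ s, Y a) = ∑ a ∈ s, X ⊗ₖ Y a := by
  ext i j
  simp [Matrix.sum_apply, Finset.mul_sum]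

theorem tensor₃_mul {n : Type*} [Fintype n] (X Y Z X' Y' Z' : Matrix n n ℂ) :
    tensor₃ X Y Z * tensor₃ X' Y' Z' = tensor₃ (X * X') (Y * Y') (Z * Z') := by
  rw [tensor₃, tensor₃, ← Matrix.mul_kronecker_mul, ← Matrix.mul_kronecker_mul]

theorem isHermitian_tensor₃ {n : Type*} {X Y Z : Matrix n n ℂ} (hX : X.IsHermitian) (hY : Y.IsHermitian)
    (hZ : Z.IsHermitian) : (tensor₃ X Y Z).IsHermitian := by
  rw [Matrix.IsHermitian, tensor₃, Matrix.conjTranspose_kronecker,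
    Matrix.conjTranspose_kronecker, hX.eq, hY.eq, hZ.eq]

theorem expvalLin_tensor₃_swap₁₂ {n : Type*} [Fintype n] {ψ : n × n × n → ℂ}
    (h : ∀ i j k, ψ (i, j, k) = ψ (j, i, k)) (X Y Z : Matrix n n ℂ) :
    expvalLin ψ (tensor₃ X Y Z) = expvalLin ψ (tensor₃ Y X Z) := by
  let e : n × n × n ≃ n × n × n :=
    ⟨fun p => (p.2.1, p.1, p.2.2), fun p => (p.2.1, p.1, p.2.2), fun _ => rfl, fun _ => rfl⟩
  rw [← expvalLin_submatrix e (fun p => h _ _ _) (tensor₃ Y X Z)]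
  congr 1
  ext i j
  simp [e, mul_left_comm]

theorem expvalLin_tensor₃_swap₂₃ {n : Type*} [Fintype n] {ψ : n × n × n → ℂ}
    (h : ∀ i j k, ψ (i, j, k) = ψ (i, k, j)) (X Y Z : Matrix n n ℂ) :
    expvalLin ψ (tensor₃ X Y Z) = expvalLin ψ (tensor₃ X Z Y) := by
  let e : n × n × n ≃ n × n × n :=
    ⟨fun p => (p.1, p.2.2, p.2.1), fun p => (p.1, p.2.2, p.2.1), fun _ => rfl, fun _ => rfl⟩
  rw [← expvalLin_submatrix e (fun p => h _ _ _) (tensor₃ X Z Y)]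
  congr 1
  ext i j
  simp [e, mul_comm]

/-- The probability that measuring `V` on two of the three registers gives equal outcomes. -/
noncomputable def agreement {n : Type*} [Fintype n] [DecidableEq n] {A : Type*} [Fintype A]
    (ψ : n × n × n → ℂ) (V : A → Matrix n n ℂ) : ℝ :=
  ∑ a, expvalLin ψ (tensor₃ (V a) (V a) 1)

section Disturbance

variable {n : Type*} [Fintype n] [DecidableEq n] {A : Type*} [Fintype A]
  {ψ : n × n × n → ℂ} {V : A → Matrix n n ℂ}

theorem expvalLin_sum_sub_sq (hψ : nsq ψ = 1) (h23 : ∀ i j k, ψ (i, j, k) = ψ (i, k, j))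
    (hV : IsProjMeas V) :
    expvalLin ψ (∑ a, (tensor₃ (V a) 1 1 - tensor₃ 1 1 (V a)) *
      (tensor₃ (V a) 1 1 - tensor₃ 1 1 (V a))) = 2 - 2 * agreement ψ V := by
  have h : ∑ a, (tensor₃ (V a) 1 1 - tensor₃ 1 1 (V a)) *
      (tensor₃ (V a) 1 1 - tensor₃ 1 1 (V a)) =
      (2 : ℝ) • 1 - (2 : ℝ) • ∑ a, tensor₃ (V a) 1 (V a) := by
    simp only [sub_mul, mul_sub, tensor₃_mul, hV.2.1, mul_one, one_mul, Finset.sum_sub_distrib]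
    simp only [tensor₃, ← sum_kronecker, ← kronecker_sum, hV.2.2, Matrix.one_kronecker_one]
    module
  rw [h, map_sub, map_smul, map_smul, expvalLin_one, hψ, map_sum, agreement]
  simp only [expvalLin_tensor₃_swap₂₃ h23 _ 1, smul_eq_mul, mul_one]

theorem expvalLin_sum_add_sq (hψ : nsq ψ = 1) (h23 : ∀ i j k, ψ (i, j, k) = ψ (i, k, j))
    (hV : IsProjMeas V) :
    expvalLin ψ (∑ a, (tensor₃ (V a) 1 1 + tensor₃ 1 1 (V a)) *
      (tensor₃ (V a) 1 1 + tensor₃ 1 1 (V a))) = 2 + 2 * agreement ψ V := by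
  have h : ∑ a, (tensor₃ (V a) 1 1 + tensor₃ 1 1 (V a)) *
      (tensor₃ (V a) 1 1 + tensor₃ 1 1 (V a)) =
      (2 : ℝ) • 1 + (2 : ℝ) • ∑ a, tensor₃ (V a) 1 (V a) := by
    simp only [add_mul, mul_add, tensor₃_mul, hV.2.1, mul_one, one_mul, Finset.sum_add_distrib]
    simp only [tensor₃, ← sum_kronecker, ← kronecker_sum, hV.2.2, Matrix.one_kronecker_one]
    module
  rw [h, map_add, map_smul, map_smul, expvalLin_one, hψ, map_sum, agreement]
  simp only [expvalLin_tensor₃_swap₂₃ h23 _ 1, smul_eq_mul, mul_one]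

theorem agreement_le_one (hψ : nsq ψ = 1) (h23 : ∀ i j k, ψ (i, j, k) = ψ (i, k, j))
    (hV : IsProjMeas V) : agreement ψ V ≤ 1 := by
  have h : 0 ≤ 2 - 2 * agreement ψ V := by
    rw [← expvalLin_sum_sub_sq hψ h23 hV]
    refine expvalLin_nonneg ψ (Matrix.posSemidef_sum _ fun a _ => ?_)
    have hH : (tensor₃ (V a) 1 1 - tensor₃ 1 1 (V a)).IsHermitian :=
      (isHermitian_tensor₃ (hV.1 a) Matrix.isHermitian_one Matrix.isHermitian_one).sub
        (isHermitian_tensor₃ Matrix.isHermitian_one Matrix.isHermitian_one (hV.1 a))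
    have h := Matrix.posSemidef_self_mul_conjTranspose
      (tensor₃ (V a) 1 1 - tensor₃ 1 1 (V a))
    rwa [hH.eq] at h
  linarith

/-- A measurement on which two registers nearly agree hardly disturbs the joint outcome
distribution of measurements on the first two registers, when performed on the first. -/
theorem sum_abs_expvalLin_pinch_sub_le {β γ : Type*} [Fintype β] [Fintype γ]
    (hψ : nsq ψ = 1) (h23 : ∀ i j k, ψ (i, j, k) = ψ (i, k, j)) (hV : IsProjMeas V)
    {X : β → Matrix n n ℂ} {Y : γ → Matrix n n ℂ} (hX : IsPovm X) (hY : IsPovm Y)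
    {t : ℝ} (ht : 0 < t) :
    ∑ b, ∑ c, |expvalLin ψ (tensor₃ (pinch V (X b)) (Y c) 1) -
      expvalLin ψ (tensor₃ (X b) (Y c) 1)| ≤ t * (1 - agreement ψ V) + 2 / t := by
  have h := sum_abs_expvalLin_conj_sub_conj_le ψ (U := fun a => tensor₃ (V a) 1 1)
    (V := fun a => tensor₃ 1 1 (V a)) (N := fun p : β × γ => tensor₃ (X p.1) (Y p.2) 1)
    (fun a => isHermitian_tensor₃ (hV.1 a) Matrix.isHermitian_one Matrix.isHermitian_one)
    (fun a => isHermitian_tensor₃ Matrix.isHermitian_one Matrix.isHermitian_one (hV.1 a))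
    (fun p => (hX.1 _).kronecker ((hY.1 _).kronecker Matrix.PosSemidef.one))
    (by
      simp only [Fintype.sum_prod_type, tensor₃, ← sum_kronecker, ← kronecker_sum, hX.2, hY.2,
        Matrix.one_kronecker_one]) ht
  rw [expvalLin_sum_sub_sq hψ h23 hV, expvalLin_sum_add_sq hψ h23 hV] at h
  simp only [Fintype.sum_prod_type, tensor₃_mul, mul_one, one_mul, hV.2.1] at h
  have h2 : ∑ b, ∑ c, |expvalLin ψ (tensor₃ (pinch V (X b)) (Y c) 1) -
      expvalLin ψ (tensor₃ (X b) (Y c) 1)| ≤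
        t / 2 * (2 - 2 * agreement ψ V) + 1 / (2 * t) * (2 + 2 * agreement ψ V) := by
    simpa only [tensor₃, ← sum_kronecker, ← kronecker_sum, hV.2.2, pinch] using h
  refine h2.trans ?_
  have h3 := agreement_le_one hψ h23 hV
  have h4 : 1 / (2 * t) * (2 + 2 * agreement ψ V) ≤ 1 / (2 * t) * 4 := by gcongr; linarith
  have h5 : 1 / (2 * t) * 4 = 2 / t := by field_simp; norm_num
  linarith

theorem sum_abs_expvalLin_foldr_pinch_sub_le {β γ : Type*} [Fintype β] [Fintype γ]
    (hψ : nsq ψ = 1) (h23 : ∀ i j k, ψ (i, j, k) = ψ (i, k, j))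
    {X : β → Matrix n n ℂ} {Y : γ → Matrix n n ℂ} (hX : IsPovm X) (hY : IsPovm Y)
    {t : ℝ} (ht : 0 < t) {L : List (A → Matrix n n ℂ)} (hL : ∀ V ∈ L, IsProjMeas V) :
    ∑ b, ∑ c, |expvalLin ψ (tensor₃ (L.foldr pinch (X b)) (Y c) 1) -
      expvalLin ψ (tensor₃ (X b) (Y c) 1)| ≤
        (L.map fun V => t * (1 - agreement ψ V) + 2 / t).sum := by
  induction L with
  | nil => simp
  | cons V L ih =>
    have hL' : ∀ V ∈ L, IsProjMeas V := fun V' h => hL V' (List.mem_cons_of_mem _ h)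
    have h1 := sum_abs_expvalLin_pinch_sub_le hψ h23 (hL V List.mem_cons_self)
      (hX.foldr_pinch hL') hY ht
    rw [List.map_cons, List.sum_cons]
    refine le_trans ?_ (add_le_add h1 (ih hL'))
    simp only [← Finset.sum_add_distrib, List.foldr_cons]
    gcongr
    exact abs_sub_le _ _ _

theorem sum_abs_expvalLin_foldr_pinch_foldr_pinch_sub_le {β γ : Type*} [Fintype β] [Fintype γ]
    (hψ : nsq ψ = 1) (h12 : ∀ i j k, ψ (i, j, k) = ψ (j, i, k))
    (h23 : ∀ i j k, ψ (i, j, k) = ψ (i, k, j))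
    {X : β → Matrix n n ℂ} {Y : γ → Matrix n n ℂ} (hX : IsPovm X) (hY : IsPovm Y)
    {t : ℝ} (ht : 0 < t) {L L' : List (A → Matrix n n ℂ)} (hL : ∀ V ∈ L, IsProjMeas V)
    (hL' : ∀ V ∈ L', IsProjMeas V) :
    ∑ b, ∑ c, |expvalLin ψ (tensor₃ (L.foldr pinch (X b)) (L'.foldr pinch (Y c)) 1) -
      expvalLin ψ (tensor₃ (X b) (Y c) 1)| ≤
        (L.map fun V => t * (1 - agreement ψ V) + 2 / t).sum +
          (L'.map fun V => t * (1 - agreement ψ V) + 2 / t).sum := by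
  have h1 := sum_abs_expvalLin_foldr_pinch_sub_le hψ h23 hX (hY.foldr_pinch hL') ht hL
  have h2 := sum_abs_expvalLin_foldr_pinch_sub_le hψ h23 hY hX ht hL'
  rw [Finset.sum_comm] at h2
  simp only [expvalLin_tensor₃_swap₁₂ h12 _ (X _)] at h2
  refine le_trans ?_ (add_le_add h1 h2)
  simp only [← Finset.sum_add_distrib]
  gcongr
  exact abs_sub_le _ _ _

end Disturbance

end Positivity

theorem descProd_succ {d n : ℕ} {A : Type*}
    (W : Fin (n + 1) → A → Matrix (Fin d) (Fin d) ℂ) (f : Fin (n + 1) → A) :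
    descProd W f = descProd (fun l => W l.succ) (fun l => f l.succ) * W 0 (f 0) := by
  simp [descProd, List.finRange_succ, Function.comp_def]

/-- The observable of the event that the `i`-th outcome is `x` when the measurements
`W 0, W 1, …` are performed in order. -/
noncomputable def marginalEffect {d n : ℕ} {A : Type*} [Fintype A] [DecidableEq A]
    (W : Fin n → A → Matrix (Fin d) (Fin d) ℂ) (i : Fin n) (x : A) :
    Matrix (Fin d) (Fin d) ℂ :=
  ∑ f : Fin n → A, if f i = x then (descProd W f).conjTranspose * descProd W f else 0

theorem sum_fin_succ_arrow {A M : Type*} [Fintype A] [AddCommMonoid M] {n : ℕ}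
    (F : (Fin (n + 1) → A) → M) :
    ∑ f, F f = ∑ a, ∑ g : Fin n → A, F (Fin.cons a g) := by
  rw [← (Fin.consEquiv fun _ => A).sum_comp, Fintype.sum_prod_type]
  rfl

theorem sum_descProd_conjTranspose_mul {d n : ℕ} {A : Type*} [Fintype A]
    (W : Fin n → A → Matrix (Fin d) (Fin d) ℂ) (hW : ∀ i, IsProjMeas (W i)) :
    ∑ f : Fin n → A, (descProd W f).conjTranspose * descProd W f = 1 := by
  induction n with
  | zero => simp [descProd]
  | succ n ih =>
    rw [sum_fin_succ_arrow]
    have h := ih (fun l => W l.succ) fun l => hW l.succ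
    simp only [descProd_succ, Fin.cons_zero, Fin.cons_succ, Matrix.conjTranspose_mul,
      ((hW 0).1 _).eq, mul_assoc, ← Finset.mul_sum]
    simp only [← mul_assoc, ← Finset.sum_mul, h, one_mul, (hW 0).2.1, (hW 0).2.2]

theorem marginalEffect_eq_foldr_pinch {d n : ℕ} {A : Type*} [Fintype A] [DecidableEq A]
    (W : Fin n → A → Matrix (Fin d) (Fin d) ℂ) (hW : ∀ i, IsProjMeas (W i)) (i : Fin n) (x : A) :
    marginalEffect W i x =
      (((List.finRange n).filter (· < i)).map W).foldr pinch (W i x) := by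
  induction n with
  | zero => exact i.elim0
  | succ n ih =>
    have hc : ∀ (a : A) (X Y : Matrix (Fin d) (Fin d) ℂ),
        (X * W 0 a).conjTranspose * (Y * W 0 a) = W 0 a * (X.conjTranspose * Y) * W 0 a := by
      intro a X Y
      rw [Matrix.conjTranspose_mul, ((hW 0).1 a).eq]
      simp only [mul_assoc]
    rw [marginalEffect, sum_fin_succ_arrow]
    simp only [descProd_succ, Fin.cons_zero, Fin.cons_succ, hc]
    refine Fin.cases ?_ (fun i => ?_) i
    · have h := sum_descProd_conjTranspose_mul (fun l => W l.succ) fun l => hW l.succ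
      simp [← Finset.mul_sum, ← Finset.sum_mul, h, (hW 0).2.1, Finset.sum_ite_irrel]
    · have h := ih (fun l => W l.succ) (fun l => hW l.succ) i
      have hL : (List.finRange (n + 1)).filter (· < i.succ) =
          0 :: ((List.finRange n).filter (· < i)).map Fin.succ := by
        simp [List.finRange_succ, List.filter_map, Function.comp_def]
      rw [hL, List.map_cons, List.foldr_cons, List.map_map, Function.comp_def, ← h, pinch,
        marginalEffect]
      simp only [Finset.mul_sum, Finset.sum_mul, mul_ite, ite_mul, mul_zero, zero_mul,
        Fin.cons_succ]

theorem sum_map_filter_lt_finRange {n : ℕ} (δ : Fin n → ℝ) (i : Fin n) :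
    (((List.finRange n).filter (· < i)).map δ).sum = ∑ k, if k < i then δ k else 0 := by
  rw [Fin.sum_univ_def]
  induction List.finRange n with
  | nil => simp
  | cons k L ih => by_cases h : k < i <;> simp [h, ih]

/-- Averaging over the questions: earlier questions are the more likely ones. -/
theorem sum_mul_sum_lt_le {n : ℕ} {m δ : Fin n → ℝ} (hm : Antitone m) (hm0 : ∀ i, 0 ≤ m i)
    (hδ : ∀ k, 0 ≤ δ k) :
    ∑ i, m i * ∑ k, (if k < i then δ k else 0) ≤ n * ∑ k, m k * δ k := by
  calc ∑ i, m i * ∑ k, (if k < i then δ k else 0) ≤ ∑ _i : Fin n, ∑ k, m k * δ k := by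
        refine Finset.sum_le_sum fun i _ => ?_
        rw [Finset.mul_sum]
        refine Finset.sum_le_sum fun k _ => ?_
        split_ifs with h
        · exact mul_le_mul_of_nonneg_right (hm h.le) (hδ k)
        · simpa using mul_nonneg (hm0 k) (hδ k)
    _ = _ := by simp

theorem sum_ite_nsq_descProd {d n : ℕ} {A : Type*} [Fintype A] [DecidableEq A]
    (W : Fin n → A → Matrix (Fin d) (Fin d) ℂ) (ψ : Fin d × Fin d × Fin d → ℂ)
    (i j : Fin n) (x y : A) :
    (∑ a : Fin n → A, ∑ a' : Fin n → A, if a i = x ∧ a' j = y then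
      nsq ((descProd W a ⊗ₖ (descProd W a' ⊗ₖ (1 : Matrix (Fin d) (Fin d) ℂ))).mulVec ψ)
      else 0) = expvalLin ψ (tensor₃ (marginalEffect W i x) (marginalEffect W j y) 1) := by
  simp only [tensor₃, marginalEffect, sum_kronecker, kronecker_sum, map_sum]
  rw [Finset.sum_comm]
  refine Finset.sum_congr rfl fun a' _ => Finset.sum_congr rfl fun a _ => ?_
  rw [nsq_mulVec]
  by_cases h : a i = x <;> by_cases h' : a' j = y <;>
    simp [h, h', Matrix.conjTranspose_kronecker, ← Matrix.mul_kronecker_mul]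

/-- The bound on the total distance before optimizing over the free parameter `t`. -/
theorem sum_mul_sum_abs_le {d n : ℕ} {A : Type*} [Fintype A] [DecidableEq A]
    {W : Fin n → A → Matrix (Fin d) (Fin d) ℂ} (hW : ∀ i, IsProjMeas (W i))
    {ψ : Fin d × Fin d × Fin d → ℂ} (hψ : nsq ψ = 1)
    (h12 : ∀ i j k, ψ (i, j, k) = ψ (j, i, k)) (h23 : ∀ i j k, ψ (i, j, k) = ψ (i, k, j))
    {π : Fin n → Fin n → ℝ} (hπ0 : ∀ i j, 0 ≤ π i j) (hπ1 : ∑ i, ∑ j, π i j = 1)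
    (hπsym : ∀ i j, π i j = π j i) (hord : Antitone fun i => ∑ l, π i l) {t : ℝ} (ht : 0 < t) :
    ∑ i, ∑ j, π i j * ∑ x, ∑ y,
        |expvalLin ψ (tensor₃ (marginalEffect W i x) (marginalEffect W j y) 1) -
          expvalLin ψ (tensor₃ (W i x) (W j y) 1)| ≤
      2 * n * (t * (1 - ∑ i, (∑ l, π i l) * agreement ψ (W i)) + 2 / t) := by
  set δ : Fin n → ℝ := fun k => t * (1 - agreement ψ (W k)) + 2 / t with hδdef
  set S : Fin n → ℝ := fun i => ∑ k, if k < i then δ k else 0 with hS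
  have hδ : ∀ k, 0 ≤ δ k := fun k =>
    add_nonneg (mul_nonneg ht.le (sub_nonneg.2 (agreement_le_one hψ h23 (hW k)))) (by positivity)
  have hpair : ∀ i j, ∑ x, ∑ y,
      |expvalLin ψ (tensor₃ (marginalEffect W i x) (marginalEffect W j y) 1) -
        expvalLin ψ (tensor₃ (W i x) (W j y) 1)| ≤ S i + S j := by
    intro i j
    have hmem : ∀ i : Fin n, ∀ V ∈ ((List.finRange n).filter (· < i)).map W, IsProjMeas V := by
      intro i V hV
      obtain ⟨k, -, rfl⟩ := List.mem_map.1 hV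
      exact hW k
    have h := sum_abs_expvalLin_foldr_pinch_foldr_pinch_sub_le hψ h12 h23 (hW i).isPovm
      (hW j).isPovm ht (hmem i) (hmem j)
    simpa only [List.map_map, Function.comp_def, sum_map_filter_lt_finRange,
      ← marginalEffect_eq_foldr_pinch W hW] using h
  have hswap : ∑ i, ∑ j, π i j * S j = ∑ i, ∑ j, π i j * S i := by
    rw [Finset.sum_comm]
    simp only [hπsym]
  calc _ ≤ ∑ i, ∑ j, π i j * (S i + S j) := by
        gcongr with i _ j _
        · exact hπ0 i j
        · exact hpair i j
    _ = 2 * ∑ i, (∑ l, π i l) * S i := by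
        simp only [mul_add, Finset.sum_add_distrib, hswap, Finset.sum_mul]
        ring
    _ ≤ 2 * (n * ∑ k, (∑ l, π k l) * δ k) := by
        gcongr
        exact sum_mul_sum_lt_le hord (fun i => Finset.sum_nonneg fun l _ => hπ0 i l) hδ
    _ = _ := by
        have h : ∑ k, (∑ l, π k l) * δ k =
            t * (1 - ∑ i, (∑ l, π i l) * agreement ψ (W i)) + 2 / t := by
          simp only [hδdef, mul_add, mul_sub, mul_one, Finset.sum_add_distrib,
            Finset.sum_sub_distrib, ← Finset.sum_mul, hπ1, one_mul, mul_left_comm _ t,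
            ← Finset.mul_sum]
        rw [h]
        ring

theorem le_mul_sqrt_of_forall_pos {x c ε : ℝ} (hc : 0 ≤ c) (hε : 0 ≤ ε)
    (h : ∀ t : ℝ, 0 < t → x ≤ c * (t * ε + 2 / t)) : x ≤ 3 * c * √ε := by
  rcases hε.eq_or_lt with rfl | hε
  · rw [Real.sqrt_zero, mul_zero]
    refine le_of_forall_pos_le_add fun η hη => ?_
    have h1 := h (2 * (c + 1) / η) (by positivity)
    have h2 : c * (2 * (c + 1) / η * 0 + 2 / (2 * (c + 1) / η)) = c / (c + 1) * η := by
      field_simp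
      simp
    have h3 : c / (c + 1) * η ≤ 1 * η := by
      gcongr
      rw [div_le_one (by positivity)]
      linarith
    linarith
  · have hs : 0 < √ε := Real.sqrt_pos.2 hε
    refine (h (1 / √ε) (by positivity)).trans_eq ?_
    have h2 : 1 / √ε * ε = √ε := by
      rw [one_div_mul_eq_div, Real.div_sqrt]
    rw [h2, div_div_eq_mul_div, div_one]
    ring

theorem stmt2 {d n : ℕ} {A : Type*} [Fintype A] [DecidableEq A]
    (W : Fin n → A → Matrix (Fin d) (Fin d) ℂ)
    (hW : ∀ i, IsProjMeas (W i))
    (ψ : Fin d × Fin d × Fin d → ℂ)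
    (hunit : nsq ψ = 1)
    -- invariance of ψ under all permutations of the three tensor factors
    (hsym12 : ∀ i j k, ψ (i, j, k) = ψ (j, i, k))
    (hsym23 : ∀ i j k, ψ (i, j, k) = ψ (i, k, j))
    (π : Fin n → Fin n → ℝ)
    (hπ0 : ∀ i j, 0 ≤ π i j) (hπ1 : ∑ i, ∑ j, π i j = 1)
    (hπsym : ∀ i j, π i j = π j i)
    -- the questions are ordered so that their marginal probabilities are nonincreasing
    (hord : ∀ i j : Fin n, i ≤ j → (∑ l, π j l) ≤ ∑ l, π i l)
    (ε : ℝ)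
    -- the consistency test succeeds on average with probability at least 1 - ε
    (hcons : 1 - ε ≤ ∑ i, (∑ l, π i l) *
        ∑ a, expval (W i a ⊗ₖ (W i a ⊗ₖ (1 : Matrix (Fin d) (Fin d) ℂ))) ψ) :
    ∑ i, ∑ j, π i j * ∑ x, ∑ y,
        |(∑ a : Fin n → A, ∑ a' : Fin n → A, if a i = x ∧ a' j = y then
            nsq ((descProd W a ⊗ₖ (descProd W a' ⊗ₖ (1 : Matrix (Fin d) (Fin d) ℂ))).mulVec ψ)
          else 0)
          - expval (W i x ⊗ₖ (W j y ⊗ₖ (1 : Matrix (Fin d) (Fin d) ℂ))) ψ|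
      ≤ 12 * n * Real.sqrt ε := by
  have hε : 0 ≤ ε := by
    have h : ∑ i, (∑ l, π i l) * agreement ψ (W i) ≤ ∑ i, (∑ l, π i l) * 1 := by
      gcongr with i _
      · exact Finset.sum_nonneg fun l _ => hπ0 i l
      · exact agreement_le_one hunit hsym23 (hW i)
    simp only [mul_one, hπ1] at h
    have h' := hcons.trans h
    linarith
  simp only [sum_ite_nsq_descProd]
  refine (le_mul_sqrt_of_forall_pos (c := 2 * n) (by positivity) hε fun t ht => ?_).trans ?_
  · refine (sum_mul_sum_abs_le hW hunit hsym12 hsym23 hπ0 hπ1 hπsym hord ht).trans ?_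
    gcongr
    exact sub_le_comm.1 hcons
  · have h : 0 ≤ n * √ε := by positivity
    linarith
end

section
/- Let G = (Q, A, π, V) be a two-prover one-round game with classical value ω(G) = max over functions f, g : Q → A of Σ_{(q,q')} π(q,q') V(f(q), g(q') | q, q'). Then there exists a two-prover one-round game G' = (Q', A, π', V') with question set Q' = Q × {1,2} (twice as many questions), such that π' is symmetric under swapping its two arguments, V' is invariant under simultaneously swapping the two questions and the two answers, ω(G') = ω(G), and moreover G' has an optimal strategy that is symmetric (i.e., achieved with both provers using the same function Q' → A). -/
/-- The classical value of a two-prover one-round game: the best winning probability over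
(deterministic) strategies `f, g : Q → A`. -/
noncomputable def gameValue {Q A : Type*} [Fintype Q]
    (π : Q → Q → ℝ) (V : A → A → Q → Q → Bool) : ℝ :=
  ⨆ f : Q → A, ⨆ g : Q → A,
    ∑ q, ∑ q', π q q' * (if V (f q) (g q') q q' then (1 : ℝ) else 0)

/-- The winning probability of the strategy pair `(f, g)`. -/
def winProb {Q A : Type*} [Fintype Q] (π : Q → Q → ℝ) (V : A → A → Q → Q → Bool)
    (f g : Q → A) : ℝ :=
  ∑ q, ∑ q', π q q' * (if V (f q) (g q') q q' then (1 : ℝ) else 0)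

theorem winProb_le_gameValue {Q A : Type*} [Fintype Q] [Finite A]
    (π : Q → Q → ℝ) (V : A → A → Q → Q → Bool) (f g : Q → A) :
    winProb π V f g ≤ gameValue π V :=
  (le_ciSup (f := fun g => winProb π V f g) (Set.finite_range _).bddAbove g).trans
    (le_ciSup (f := fun f => ⨆ g, winProb π V f g) (Set.finite_range _).bddAbove f)

theorem exists_winProb_eq_gameValue {Q A : Type*} [Fintype Q] [Finite A] [Nonempty A]
    (π : Q → Q → ℝ) (V : A → A → Q → Q → Bool) :
    ∃ f g : Q → A, winProb π V f g = gameValue π V := by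
  obtain ⟨f, hf⟩ := exists_eq_ciSup_of_finite (f := fun f => ⨆ g, winProb π V f g)
  obtain ⟨g, hg⟩ := exists_eq_ciSup_of_finite (f := fun g => winProb π V f g)
  exact ⟨f, g, hg.trans hf⟩

/-- The symmetrized question distribution: a fair coin decides which prover plays which role, and
the role is part of the question. -/
noncomputable def symmDist {Q : Type*} (π : Q → Q → ℝ) (p p' : Q × Fin 2) : ℝ :=
  if p.2 = p'.2 then 0 else if p.2 = 0 then π p.1 p'.1 / 2 else π p'.1 p.1 / 2

/-- The predicate of the symmetrized game, which reads the roles off the questions. -/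
def symmPred {Q A : Type*} (V : A → A → Q → Q → Bool) (a a' : A) (p p' : Q × Fin 2) : Bool :=
  if p.2 = p'.2 then false else if p.2 = 0 then V a a' p.1 p'.1 else V a' a p'.1 p.1

theorem symmDist_comm {Q : Type*} (π : Q → Q → ℝ) (p p' : Q × Fin 2) :
    symmDist π p p' = symmDist π p' p := by
  obtain ⟨q, i⟩ := p
  obtain ⟨q', j⟩ := p'
  fin_cases i <;> fin_cases j <;> simp [symmDist]

theorem symmPred_comm {Q A : Type*} (V : A → A → Q → Q → Bool) (a a' : A) (p p' : Q × Fin 2) :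
    symmPred V a a' p p' = symmPred V a' a p' p := by
  obtain ⟨q, i⟩ := p
  obtain ⟨q', j⟩ := p'
  fin_cases i <;> fin_cases j <;> simp [symmPred]

theorem symmDist_nonneg {Q : Type*} {π : Q → Q → ℝ} (hπ : ∀ q q', 0 ≤ π q q')
    (p p' : Q × Fin 2) : 0 ≤ symmDist π p p' := by
  have h₁ := hπ p.1 p'.1
  have h₂ := hπ p'.1 p.1
  unfold symmDist
  split_ifs <;> positivity

theorem sum_symmDist {Q : Type*} [Fintype Q] (π : Q → Q → ℝ) :
    ∑ p, ∑ p', symmDist π p p' = ∑ q, ∑ q', π q q' := by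
  simp only [Fintype.sum_prod_type, Fin.sum_univ_two, symmDist, Finset.sum_add_distrib]
  simp only [if_true, zero_ne_one, one_ne_zero, if_false, Finset.sum_const_zero, zero_add,
    add_zero, ← Finset.sum_div]
  rw [Finset.sum_comm (f := fun q q' => π q' q), add_halves]

theorem winProb_symm {Q A : Type*} [Fintype Q] (π : Q → Q → ℝ) (V : A → A → Q → Q → Bool)
    (f g : Q × Fin 2 → A) :
    winProb (symmDist π) (symmPred V) f g =
      (winProb π V (fun q => f (q, 0)) (fun q => g (q, 1)) +
        winProb π V (fun q => g (q, 0)) (fun q => f (q, 1))) / 2 := by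
  simp only [winProb, Fintype.sum_prod_type, Fin.sum_univ_two, symmDist, symmPred,
    Finset.sum_add_distrib]
  simp only [if_true, zero_ne_one, one_ne_zero, if_false, zero_mul, Finset.sum_const_zero,
    zero_add, add_zero, div_mul_eq_mul_div, ← Finset.sum_div]
  rw [Finset.sum_comm
    (f := fun q q' => π q' q * if V (g (q', 0)) (f (q, 1)) q' q then (1 : ℝ) else 0), add_div, add_comm]

theorem stmt9 {Q A : Type*} [Fintype Q] [Fintype A] [Nonempty A]
    (π : Q → Q → ℝ)
    (hπ0 : ∀ q q', 0 ≤ π q q') (hπ1 : ∑ q, ∑ q', π q q' = 1)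
    (V : A → A → Q → Q → Bool) :
    ∃ (π' : Q × Fin 2 → Q × Fin 2 → ℝ) (V' : A → A → Q × Fin 2 → Q × Fin 2 → Bool),
      -- π' is a probability distribution on the doubled question set
      (∀ p p', 0 ≤ π' p p') ∧ (∑ p, ∑ p', π' p p' = 1) ∧
      -- π' is symmetric under swapping its two arguments
      (∀ p p', π' p p' = π' p' p) ∧
      -- V' is invariant under simultaneously swapping the two questions and the two answers
      (∀ a a' p p', V' a a' p p' = V' a' a p' p) ∧
      -- the modified game has the same value
      gameValue π' V' = gameValue π V ∧
      -- and it has an optimal symmetric strategy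
      (∃ h : Q × Fin 2 → A,
        ∑ p, ∑ p', π' p p' * (if V' (h p) (h p') p p' then (1 : ℝ) else 0)
          = gameValue π' V') := by
  obtain ⟨f, g, hfg⟩ := exists_winProb_eq_gameValue π V
  have hsymm : winProb (symmDist π) (symmPred V) (fun p => if p.2 = 0 then f p.1 else g p.1)
      (fun p => if p.2 = 0 then f p.1 else g p.1) = gameValue π V := by
    simp [winProb_symm, hfg]
  have hval : gameValue (symmDist π) (symmPred V) = gameValue π V := by
    apply le_antisymm
    · obtain ⟨F, G, hFG⟩ := exists_winProb_eq_gameValue (symmDist π) (symmPred V)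
      rw [← hFG, winProb_symm]
      linarith [winProb_le_gameValue π V (fun q => F (q, 0)) (fun q => G (q, 1)),
        winProb_le_gameValue π V (fun q => G (q, 0)) (fun q => F (q, 1))]
    · exact hsymm.symm.trans_le (winProb_le_gameValue _ _ _ _)
  exact ⟨symmDist π, symmPred V, symmDist_nonneg hπ0, (sum_symmDist π).trans hπ1,
    symmDist_comm π, symmPred_comm V, hval, _, hsymm.trans hval.symm⟩
end
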